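/- arXiv:1201.5842 — 2 statements merged into one kernel-verified Lean document; each statement's English description precedes it below -/
import Mathlib

section
/- Let p be the unique root in (0,1) of p³ = (1−p)². Then Σ_{k=1}^∞ 2^{−(k+1)} H(p) F_{k−1}(p) = −log₂ p, and Σ_{k=1}^∞ 2^{−(k+1)} (H·F_{k−1})′(p) = 0, where (H·F_{k−1})′(p) denotes the derivative of x ↦ H(x)F_{k−1}(x) at x = p. -/
open scoped Classical

noncomputable section

/-- Binary entropy function `H(r) = -r log₂ r - (1-r) log₂ (1-r)`. -/
def Hent (r : ℝ) : ℝ := -r * Real.logb 2 r - (1 - r) * Real.logb 2 (1 - r)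

/-- The polynomials `F₀(x) = 1`, `F₁(x) = 1 + x`,
`F_k(x) = 1 + x F_{k-1}(x) + (1-x) F_{k-2}(x)` for `k ≥ 2`. -/
def Fpoly : ℕ → ℝ → ℝ
  | 0, _ => 1
  | 1, x => 1 + x
  | (k + 2), x => 1 + x * Fpoly (k + 1) x + (1 - x) * Fpoly k x

theorem Fpoly_eq (k : ℕ) {x : ℝ} (hx : x ≠ 2) :
    Fpoly k x = (k + 1) / (2 - x) - (x - 1) * (1 - (x - 1) ^ (k + 1)) / (2 - x) ^ 2 := by
  have h : 2 - x ≠ 0 := sub_ne_zero.mpr hx.symm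
  induction k using Nat.twoStepInduction with
  | zero => simp only [Fpoly]; field_simp; push_cast; ring
  | one => simp only [Fpoly]; field_simp; push_cast; ring
  | more k ih₁ ih₂ => simp only [Fpoly, ih₁, ih₂]; field_simp; push_cast; ring

/-- The derivative of `Fpoly k`, in closed form. -/
theorem hasDerivAt_Fpoly (k : ℕ) {x : ℝ} (hx : x ≠ 2) :
    HasDerivAt (Fpoly k) ((k + (k + 2) * (x - 1) ^ (k + 1)) / (2 - x) ^ 2
      - 2 * (x - 1) * (1 - (x - 1) ^ (k + 1)) / (2 - x) ^ 3) x := by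
  have h : 2 - x ≠ 0 := sub_ne_zero.mpr hx.symm
  induction k using Nat.twoStepInduction with
  | zero =>
    refine (hasDerivAt_const x (1 : ℝ)).congr_deriv ?_
    field_simp; push_cast; ring
  | one =>
    refine ((hasDerivAt_id x).const_add 1).congr_deriv ?_
    field_simp; push_cast; ring
  | more k ih₁ ih₂ =>
    refine ((((hasDerivAt_id x).mul ih₂).const_add 1).add
      (((hasDerivAt_id x).const_sub 1).mul ih₁)).congr_deriv ?_
    simp only [Fpoly_eq _ hx, id_eq]
    field_simp; push_cast; ring

theorem hasSum_Fpoly {x : ℝ} (hx₀ : 0 < x) (hx₁ : x < 1) :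
    HasSum (fun k : ℕ => Fpoly k x / 2 ^ (k + 2)) (2 / (3 - x)) := by
  have h2 : 2 - x ≠ 0 := by linarith
  have h3 : 3 - x ≠ 0 := by linarith
  have hr : ‖(1 / 2 : ℝ)‖ < 1 := by norm_num
  have hq : ‖(x - 1) / 2‖ < 1 := by rw [Real.norm_eq_abs, abs_lt]; constructor <;> linarith
  have hsum := ((((hasSum_coe_mul_geometric_of_norm_lt_one hr).add
    (hasSum_geometric_of_norm_lt_one hr)).mul_left (1 / (4 * (2 - x)))).add
    ((hasSum_geometric_of_norm_lt_one hr).mul_left (-(x - 1) / (4 * (2 - x) ^ 2)))).add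
    ((hasSum_geometric_of_norm_lt_one hq).mul_left ((x - 1) ^ 2 / (4 * (2 - x) ^ 2)))
  convert hsum using 1
  · rfl
  · funext k
    rw [Fpoly_eq k (by linarith), div_pow, div_pow]
    field_simp
    ring
  · rw [show 1 - (x - 1) / 2 = (3 - x) / 2 by ring]
    field_simp
    ring

theorem hasSum_deriv_Fpoly {x : ℝ} (hx₀ : 0 < x) (hx₁ : x < 1) :
    HasSum (fun k : ℕ => deriv (Fpoly k) x / 2 ^ (k + 2)) (2 / (3 - x) ^ 2) := by
  have h2 : 2 - x ≠ 0 := by linarith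
  have h3 : 3 - x ≠ 0 := by linarith
  have hr : ‖(1 / 2 : ℝ)‖ < 1 := by norm_num
  have hq : ‖(x - 1) / 2‖ < 1 := by rw [Real.norm_eq_abs, abs_lt]; constructor <;> linarith
  have hsum := ((((hasSum_coe_mul_geometric_of_norm_lt_one hr).mul_left (1 / (4 * (2 - x) ^ 2))).add
    ((hasSum_coe_mul_geometric_of_norm_lt_one hq).mul_left ((x - 1) / (4 * (2 - x) ^ 2)))).add
    ((hasSum_geometric_of_norm_lt_one hr).mul_left (-(x - 1) / (2 * (2 - x) ^ 3)))).add
    ((hasSum_geometric_of_norm_lt_one hq).mul_left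
      ((x - 1) / (2 * (2 - x) ^ 2) + (x - 1) ^ 2 / (2 * (2 - x) ^ 3)))
  convert hsum using 1
  · rfl
  · funext k
    rw [(hasDerivAt_Fpoly k (by linarith)).deriv, div_pow, div_pow]
    field_simp
    ring
  · rw [show 1 - (x - 1) / 2 = (3 - x) / 2 by ring]
    field_simp
    ring

theorem hasDerivAt_Hent {x : ℝ} (hx₀ : x ≠ 0) (hx₁ : x ≠ 1) :
    HasDerivAt Hent (Real.logb 2 (1 - x) - Real.logb 2 x) x := by
  have h1 : 1 - x ≠ 0 := sub_ne_zero.mpr hx₁.symm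
  have hl : Real.log 2 ≠ 0 := by positivity
  have hid := hasDerivAt_id x
  refine ((hid.neg.mul ((Real.hasDerivAt_log hx₀).div_const (Real.log 2))).sub
    ((hid.const_sub 1).mul (((hid.const_sub 1).log h1).div_const (Real.log 2)))).congr_deriv ?_
  simp only [Real.logb, id_eq, Pi.neg_apply]
  field_simp
  ring

/-- With `p ∈ (0,1)` the root of `p³ = (1-p)²`:
`∑_{k≥1} 2^{-(k+1)} H(p) F_{k-1}(p) = -log₂ p` and
`∑_{k≥1} 2^{-(k+1)} (H·F_{k-1})'(p) = 0` (sums reindexed by `k ↦ k+1`). -/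
theorem sum_entropy_series (p : ℝ) (hp : p ∈ Set.Ioo (0 : ℝ) 1)
    (hpe : p ^ 3 = (1 - p) ^ 2) :
    (∑' k : ℕ, Hent p * Fpoly k p / 2 ^ (k + 2) = -Real.logb 2 p) ∧
    (∑' k : ℕ, deriv (fun x => Hent x * Fpoly k x) p / 2 ^ (k + 2) = 0) := by
  obtain ⟨hp₀, hp₁⟩ := hp
  have h3 : 3 - p ≠ 0 := by linarith
  have hlog : Real.logb 2 (1 - p) = 3 / 2 * Real.logb 2 p := by
    have h := congrArg (Real.logb 2) hpe
    rw [Real.logb_pow, Real.logb_pow] at h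
    push_cast at h
    linarith
  have hH : Hent p = -Real.logb 2 p * (3 - p) / 2 := by
    rw [Hent, hlog]
    ring
  have hF := hasSum_Fpoly hp₀ hp₁
  constructor
  · simp_rw [mul_div_assoc]
    rw [(hF.mul_left (Hent p)).tsum_eq, hH]
    field_simp
  · have hderiv (k : ℕ) : deriv (fun x => Hent x * Fpoly k x) p / 2 ^ (k + 2) =
        Real.logb 2 p / 2 * (Fpoly k p / 2 ^ (k + 2)) +
          Hent p * (deriv (Fpoly k) p / 2 ^ (k + 2)) := by
      have hFk := (hasDerivAt_Fpoly k (x := p) (by linarith)).differentiableAt.hasDerivAt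
      rw [((hasDerivAt_Hent hp₀.ne' hp₁.ne).fun_mul hFk).deriv, hlog]
      ring
    simp_rw [hderiv]
    rw [((hF.mul_left _).add ((hasSum_deriv_Fpoly hp₀ hp₁).mul_left _)).tsum_eq, hH]
    field_simp
    ring

end
end

section
/- Let (γ(n))_{n≥1} be any real sequence with sup_n |γ(n) − γ(n−1)| < ∞. Then γ(n) − γ(2n)/2 < n/log₂(2n) holds for infinitely many n. -/
theorem abs_le_of_bounded_increments {γ : ℕ → ℝ} {C : ℝ}
    (hC : ∀ n : ℕ, 1 ≤ n → |γ n - γ (n - 1)| ≤ C) (n : ℕ) : |γ n| ≤ |γ 0| + C * n := by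
  induction n with
  | zero => simp
  | succ n ih =>
    have h := hC (n + 1) n.succ_pos
    have h' := abs_add_le (γ (n + 1) - γ n) (γ n)
    rw [Nat.add_sub_cancel] at h
    rw [sub_add_cancel] at h'
    push_cast
    linarith

/-- For any real sequence `γ` with bounded increments,
`γ(n) - γ(2n)/2 < n/log₂(2n)` holds for infinitely many `n`. -/
theorem seq_infinitely_many (γ : ℕ → ℝ)
    (hC : ∃ C : ℝ, ∀ n : ℕ, 1 ≤ n → |γ n - γ (n - 1)| ≤ C) :
    ∀ N : ℕ, ∃ n : ℕ, N ≤ n ∧ 1 ≤ n ∧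
      γ n - γ (2 * n) / 2 < n / Real.logb 2 (2 * n) := by
  obtain ⟨C, hC⟩ := hC
  intro N
  by_contra! hN
  let H : ℕ → ℝ := fun k => ∑ i ∈ Finset.range k, 1 / ((i : ℝ) + 1)
  let b : ℕ → ℝ := fun k => γ (2 ^ k) / 2 ^ k + H k
  have hstep : ∀ k, N ≤ k → b (k + 1) ≤ b k := by
    intro k hk
    have h := hN (2 ^ k) (hk.trans Nat.lt_two_pow_self.le) Nat.one_le_two_pow
    have hlog : Real.logb 2 (2 * ((2 ^ k : ℕ) : ℝ)) = k + 1 := by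
      push_cast
      rw [← pow_succ', Real.logb_pow, Real.logb_self_eq_one one_lt_two]
      simp
    rw [hlog, ← pow_succ'] at h
    have hp : (0 : ℝ) < 2 ^ k := by positivity
    have h2 := div_le_div_of_nonneg_right h hp.le
    have e1 : ((2 ^ k : ℕ) : ℝ) / (k + 1) / 2 ^ k = 1 / ((k : ℝ) + 1) := by
      push_cast
      field_simp
    have e2 : (γ (2 ^ k) - γ (2 ^ (k + 1)) / 2) / 2 ^ k
        = γ (2 ^ k) / 2 ^ k - γ (2 ^ (k + 1)) / 2 ^ (k + 1) := by
      rw [pow_succ (2 : ℝ)]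
      field_simp
    rw [e1, e2] at h2
    simp only [b, H, Finset.sum_range_succ]
    linarith
  have hanti : ∀ k, N ≤ k → b k ≤ b N := fun k hk =>
    Nat.le_induction le_rfl (fun m hm ih => (hstep m hm).trans ih) k hk
  have hlow : ∀ k, -(|γ 0| + C) ≤ γ (2 ^ k) / 2 ^ k := by
    intro k
    have hp : (1 : ℝ) ≤ 2 ^ k := one_le_pow₀ one_le_two
    have h := (abs_le.mp (abs_le_of_bounded_increments hC (2 ^ k))).1
    push_cast at h
    rw [le_div_iff₀ (by positivity)]
    nlinarith [mul_le_mul_of_nonneg_left hp (abs_nonneg (γ 0))]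
  obtain ⟨k, hk, hkN⟩ := ((Real.tendsto_sum_range_one_div_nat_succ_atTop.eventually_gt_atTop
    (b N + |γ 0| + C)).and (Filter.eventually_ge_atTop N)).exists
  have h1 : γ (2 ^ k) / 2 ^ k + ∑ i ∈ Finset.range k, 1 / ((i : ℝ) + 1) ≤ b N := hanti k hkN
  linarith [hlow k]
end
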